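/- Let δ > 0, let p, q be real numbers with q ≥ 0 and p > 2q + 1, and set ϱ = (p − q)/(p − 2q − 1). Let Γ, γ > 0 and let α, β : [0,δ] → ℝ be continuous with α(r) ≥ −Γ and β(r) ≥ γ for all r ∈ [0,δ]. Define C₂(t) = ∫₀ᵗ α(r)·r^p dr and C₁(t) = ∫₀ᵗ β(r)·r^q dr for t ∈ [0,δ]. Then there exist ϑ > 0 and a sequence (t_n)_{n∈ℕ} in (0,δ] with t_n → 0 such that e^{−ϑ·n^{1/ϱ}}·exp( C₂(t_n)·n² + C₁(t_n)·n ) → +∞ as n → ∞. Consequently, for the operator D_t − i c₂(t)Δ_x + i c₁(t)D_x on the circle with c₂(t) = α(t)·t^p and c₁(t) = β(t)·t^q, the Cauchy problem with zero right-hand side and Gevrey-ϱ initial datum whose Fourier coefficients are e^{−ϑ|η|^{1/ϱ}} has solution coefficients û(t,η) = e^{−ϑ|η|^{1/ϱ}}·exp(C₂(t)η² + C₁(t)η) which are unbounded, so the problem is ill-posed in G^ϱ (and hence in G^s for every s ≥ ϱ, in C^∞ and in every H^r). -/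

import Mathlib

open intervalIntegral Filter

theorem const_mul_rpow_le_integral_mul_rpow {δ p m t : ℝ} (hp : 0 ≤ p) {α : ℝ → ℝ}
    (hα : ContinuousOn α (Set.Icc 0 δ)) (hm : ∀ r ∈ Set.Icc (0 : ℝ) δ, m ≤ α r)
    (ht : t ∈ Set.Ioc (0 : ℝ) δ) :
    m * (t ^ (p + 1) / (p + 1)) ≤ ∫ r in (0 : ℝ)..t, α r * r ^ p := by
  have hsub : Set.Icc 0 t ⊆ Set.Icc 0 δ := Set.Icc_subset_Icc_right ht.2
  have hcont : Continuous fun r : ℝ => r ^ p := Real.continuous_rpow_const hp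
  have hint : ∫ r in (0 : ℝ)..t, m * r ^ p = m * (t ^ (p + 1) / (p + 1)) := by
    rw [intervalIntegral.integral_const_mul, integral_rpow (Or.inl (by linarith)),
      Real.zero_rpow (by linarith), sub_zero]
  rw [← hint]
  refine intervalIntegral.integral_mono_on ht.1.le
    ((continuous_const.mul hcont).intervalIntegrable _ _) ?_ ?_
  · apply ContinuousOn.intervalIntegrable
    rw [Set.uIcc_of_le ht.1.le]
    exact (hα.mono hsub).mul hcont.continuousOn
  · intro r hr
    exact mul_le_mul_of_nonneg_right (hm r (hsub hr)) (Real.rpow_nonneg hr.1 p)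

/-- Critical-index blow-up in the degenerate case: if the leading imaginary coefficient
vanishes at `t = 0` to order `p` and the first-order one to order `q`, with `p > 2q + 1`,
then for some `ϑ > 0` and some sequence `t_n → 0⁺` the quantities
`e^{−ϑ n^{1/ϱ}}·exp(C₂(t_n)n² + C₁(t_n)n)` blow up, where `ϱ = (p−q)/(p−2q−1)`,
`C₂(t) = ∫₀ᵗ α(r)r^p dr` and `C₁(t) = ∫₀ᵗ β(r)r^q dr`. -/
theorem stmt19 (δ p q Γ γ : ℝ) (hδ : 0 < δ) (hq : 0 ≤ q) (hp : 2 * q + 1 < p)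
    (hΓ : 0 < Γ) (hγ : 0 < γ)
    (α β : ℝ → ℝ)
    (hα : ContinuousOn α (Set.Icc 0 δ)) (hβ : ContinuousOn β (Set.Icc 0 δ))
    (hαb : ∀ r ∈ Set.Icc (0:ℝ) δ, -Γ ≤ α r) (hβb : ∀ r ∈ Set.Icc (0:ℝ) δ, γ ≤ β r) :
    ∃ ϑ > 0, ∃ tn : ℕ → ℝ, (∀ n, tn n ∈ Set.Ioc (0:ℝ) δ)
      ∧ Filter.Tendsto tn Filter.atTop (nhds 0)
      ∧ Filter.Tendsto (fun n : ℕ =>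
          Real.exp (-ϑ * (n : ℝ) ^ (1 / ((p - q) / (p - 2 * q - 1)))) *
            Real.exp ((∫ r in (0:ℝ)..(tn n), α r * r ^ p) * (n : ℝ) ^ 2
              + (∫ r in (0:ℝ)..(tn n), β r * r ^ q) * (n : ℝ)))
          Filter.atTop Filter.atTop := by
  have hpq : 0 < p - q := by linarith
  have hd : 0 < p - 2 * q - 1 := by linarith
  have he : 0 < 1 / ((p - q) / (p - 2 * q - 1)) := by positivity
  have hp0 : 0 < p + 1 := by linarith
  have hq0 : 0 < q + 1 := by linarith
  set e := 1 / ((p - q) / (p - 2 * q - 1)) with he_def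
  obtain ⟨c, hc, hcδ, hcK⟩ :
      ∃ c > 0, c ≤ δ ∧ c ^ (p - q) ≤ γ * (p + 1) / (2 * (q + 1) * Γ) := by
    have hK : 0 < γ * (p + 1) / (2 * (q + 1) * Γ) := by positivity
    set K := γ * (p + 1) / (2 * (q + 1) * Γ)
    have hc : 0 < min δ (K ^ (p - q)⁻¹) := lt_min hδ (Real.rpow_pos_of_pos hK _)
    refine ⟨min δ (K ^ (p - q)⁻¹), hc, min_le_left _ _, ?_⟩
    calc min δ (K ^ (p - q)⁻¹) ^ (p - q) ≤ (K ^ (p - q)⁻¹) ^ (p - q) :=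
          Real.rpow_le_rpow hc.le (min_le_right _ _) hpq.le
      _ = K := Real.rpow_inv_rpow hK.le hpq.ne'
  set A := γ * (c ^ (q + 1) / (q + 1)) / 2 with hA
  have hA0 : 0 < A := by positivity
  have hbal : Γ * (c ^ (p + 1) / (p + 1)) ≤ A := by
    have hsplit : c ^ (p + 1) = c ^ (q + 1) * c ^ (p - q) := by
      rw [← Real.rpow_add hc]; ring_nf
    calc Γ * (c ^ (p + 1) / (p + 1)) = Γ * c ^ (q + 1) / (p + 1) * c ^ (p - q) := by
          rw [hsplit]; ring
      _ ≤ Γ * c ^ (q + 1) / (p + 1) * (γ * (p + 1) / (2 * (q + 1) * Γ)) := by gcongr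
      _ = A := by rw [hA]; field_simp
  set s := (p - q)⁻¹ with hs
  have hs0 : 0 < s := by positivity
  set tn : ℕ → ℝ := fun n => c * ((max n 1 : ℕ) : ℝ) ^ (-s) with htn
  have hmem : ∀ n, tn n ∈ Set.Ioc (0 : ℝ) δ := by
    intro n
    have h1 : (1 : ℝ) ≤ ((max n 1 : ℕ) : ℝ) := by exact_mod_cast le_max_right n 1
    refine ⟨mul_pos hc (Real.rpow_pos_of_pos (by linarith) _), ?_⟩
    exact (mul_le_of_le_one_right hc.le
      (Real.rpow_le_one_of_one_le_of_nonpos h1 (by linarith))).trans hcδ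
  refine ⟨A / 2, by positivity, tn, hmem, ?_, ?_⟩
  · have hmax : Tendsto (fun n : ℕ => ((max n 1 : ℕ) : ℝ)) atTop atTop :=
      tendsto_natCast_atTop_atTop.comp (tendsto_atTop_mono (fun n => le_max_left n 1) tendsto_id)
    simpa [htn] using ((tendsto_rpow_neg_atTop hs0).comp hmax).const_mul c
  · have hlim : Tendsto (fun n : ℕ => Real.exp (A / 2 * (n : ℝ) ^ e)) atTop atTop :=
      Real.tendsto_exp_atTop.comp
        (((tendsto_rpow_atTop he).comp tendsto_natCast_atTop_atTop).const_mul_atTop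
          (by positivity))
    refine tendsto_atTop_mono' _ ?_ hlim
    filter_upwards [eventually_ge_atTop 1] with n hn
    have hn0 : (0 : ℝ) < n := by exact_mod_cast hn
    have htn_eq : tn n = c * (n : ℝ) ^ (-s) := by simp only [htn, max_eq_left hn]
    have hpow : ∀ a : ℝ, tn n ^ a = c ^ a * (n : ℝ) ^ (-s * a) := fun a => by
      rw [htn_eq, Real.mul_rpow hc.le (Real.rpow_nonneg hn0.le _), ← Real.rpow_mul hn0.le]
    have hexp2 : (n : ℝ) ^ (-s * (p + 1)) * (n : ℝ) ^ 2 = (n : ℝ) ^ e := by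
      rw [← Real.rpow_natCast, ← Real.rpow_add hn0, he_def, hs]
      congr 1
      push_cast
      field_simp
      ring
    have hexp1 : (n : ℝ) ^ (-s * (q + 1)) * (n : ℝ) = (n : ℝ) ^ e := by
      rw [← Real.rpow_add_one hn0.ne', he_def, hs]
      congr 1
      field_simp
      ring
    have hC2 : -A * (n : ℝ) ^ e ≤ (∫ r in (0 : ℝ)..(tn n), α r * r ^ p) * (n : ℝ) ^ 2 := by
      calc -A * (n : ℝ) ^ e ≤ -(Γ * (c ^ (p + 1) / (p + 1))) * (n : ℝ) ^ e := by gcongr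
        _ = -Γ * (tn n ^ (p + 1) / (p + 1)) * (n : ℝ) ^ 2 := by
          rw [hpow, ← hexp2]; ring
        _ ≤ _ := by
          gcongr
          exact const_mul_rpow_le_integral_mul_rpow (by linarith) hα hαb (hmem n)
    have hC1 : 2 * A * (n : ℝ) ^ e ≤ (∫ r in (0 : ℝ)..(tn n), β r * r ^ q) * (n : ℝ) := by
      calc 2 * A * (n : ℝ) ^ e = γ * (tn n ^ (q + 1) / (q + 1)) * (n : ℝ) := by
            rw [hpow, ← hexp1, hA]; ring
        _ ≤ _ := by
          gcongr
          exact const_mul_rpow_le_integral_mul_rpow hq hβ hβb (hmem n)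
    rw [← Real.exp_add]
    apply Real.exp_le_exp.mpr
    linarith
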